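/- Let (Ω, 𝓖, (𝓖_n)_{n≥0}, P) be a discrete-time filtered probability space with 𝓖_0 trivial and 𝓖 = ∨_n 𝓖_n, and let (Z_n)_{n≥0} be a random walk with retirement. Then there exists a probability measure Q equivalent to P such that (Z_n, 𝓖_n)_{n≥0} is a uniformly integrable martingale under Q. -/

import Mathlib

open MeasureTheory Set Filter

noncomputable section

open scoped ENNReal Topology

/-- Integrating an `m`-measurable function over an event is the same as integrating it against the
conditional probability of that event. -/
lemma lintegral_mul_indicator_eq_lintegral_mul_condExp {Ω : Type*} {m m0 : MeasurableSpace Ω}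
    (P : Measure Ω) [IsFiniteMeasure P] (hm : m ≤ m0) {f : Ω → ℝ≥0∞} (hf : Measurable[m] f)
    {A : Set Ω} (hA : MeasurableSet A) :
    ∫⁻ ω, f ω * A.indicator 1 ω ∂P
      = ∫⁻ ω, f ω * ENNReal.ofReal ((P[A.indicator (fun _ => (1 : ℝ)) | m]) ω) ∂P := by
  have hY : Measurable fun ω => ENNReal.ofReal ((P[A.indicator (fun _ => (1 : ℝ)) | m]) ω) :=
    (stronglyMeasurable_condExp.mono hm).measurable.ennreal_ofReal
  have hX : Measurable (A.indicator (1 : Ω → ℝ≥0∞)) := measurable_one.indicator hA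
  have hint : Integrable (A.indicator (fun _ => (1 : ℝ))) P := (integrable_const 1).indicator hA
  have key : (P.withDensity (A.indicator 1)).trim hm
      = (P.withDensity fun ω =>
          ENNReal.ofReal ((P[A.indicator (fun _ => (1 : ℝ)) | m]) ω)).trim hm := by
    refine @Measure.ext _ m _ _ fun s hs => ?_
    rw [trim_measurableSet_eq hm hs, trim_measurableSet_eq hm hs,
      withDensity_apply _ (hm s hs), withDensity_apply _ (hm s hs),
      ← ofReal_integral_eq_lintegral_ofReal integrable_condExp.integrableOn
        (ae_restrict_of_ae (condExp_nonneg (ae_of_all _ fun ω =>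
          indicator_nonneg (fun _ _ => zero_le_one) ω))),
      setIntegral_condExp hm hint hs, ofReal_integral_eq_lintegral_ofReal hint.integrableOn
        (ae_of_all _ fun ω => indicator_nonneg (fun _ _ => zero_le_one) ω)]
    refine lintegral_congr fun ω => ?_
    by_cases h : ω ∈ A <;> simp [h]
  have h := congrArg (fun μ => @lintegral Ω m μ f) key
  simp only [lintegral_trim hm hf] at h
  rw [lintegral_withDensity_eq_lintegral_mul _ hX (hf.mono hm le_rfl),
    lintegral_withDensity_eq_lintegral_mul _ hY (hf.mono hm le_rfl)] at h
  simpa only [Pi.mul_apply, mul_comm] using h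

/-- A family dominated by an integrable function is uniformly integrable. -/
lemma uniformIntegrable_of_norm_le {Ω ι : Type*} {m : MeasurableSpace Ω} {μ : Measure Ω}
    {f : ι → Ω → ℝ} {G : Ω → ℝ} (hf : ∀ i, AEStronglyMeasurable (f i) μ) (hG : Integrable G μ)
    (hle : ∀ i, ∀ᵐ ω ∂μ, ‖f i ω‖ ≤ ‖G ω‖) : UniformIntegrable f 1 μ := by
  have hG1 : MemLp G 1 μ := memLp_one_iff_integrable.2 hG
  refine ⟨hf, fun η hη => ?_, (eLpNorm G 1 μ).toNNReal, fun i => ?_⟩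
  · obtain ⟨d, hd, h⟩ := unifIntegrable_const (ι := ι) le_rfl ENNReal.one_ne_top hG1 hη
    refine ⟨d, hd, fun i s hs hμs => le_trans (eLpNorm_mono_ae ?_) (h i s hs hμs)⟩
    filter_upwards [hle i] with ω hω
    by_cases hs : ω ∈ s <;> simp [hs]
    simpa using hω
  · rw [ENNReal.coe_toNNReal hG1.eLpNorm_ne_top]
    exact eLpNorm_mono_ae (hle i)

/-- The one-step density that turns the conditional law of `R (n + 1)` given `𝒢 n` into `w` on the
event `R n ≠ 0`, and changes nothing on the event `R n = 0`. -/
def stepDensity {Ω : Type*} {m : MeasurableSpace Ω} (P : Measure Ω) (𝒢 : Filtration ℕ m)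
    (R : ℕ → Ω → ℝ) (J : Finset ℝ) (w : ℝ → ℝ≥0∞) (n : ℕ) (ω : Ω) : ℝ≥0∞ :=
  if R n ω = 0 then 1 else
    ∑ j ∈ J, {ω' | R (n + 1) ω' = j}.indicator (fun ω' => w j /
      ENNReal.ofReal ((P[({ω' | R (n + 1) ω' = j}).indicator (fun _ => (1:ℝ)) | 𝒢 n]) ω')) ω

/-- The product of the first `n` one-step densities. -/
def pathDensity {Ω : Type*} {m : MeasurableSpace Ω} (P : Measure Ω) (𝒢 : Filtration ℕ m)
    (R : ℕ → Ω → ℝ) (J : Finset ℝ) (w : ℝ → ℝ≥0∞) (n : ℕ) (ω : Ω) : ℝ≥0∞ :=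
  ∏ i ∈ Finset.range n, stepDensity P 𝒢 R J w i ω

/-- The limiting density; at a path retired by time `k` it is the product of the first `k` one-step
densities. -/
def limitDensity {Ω : Type*} {m : MeasurableSpace Ω} (P : Measure Ω) (𝒢 : Filtration ℕ m)
    (R : ℕ → Ω → ℝ) (J : Finset ℝ) (w : ℝ → ℝ≥0∞) (ω : Ω) : ℝ≥0∞ :=
  liminf (fun n => pathDensity P 𝒢 R J w n ω) atTop

section Density

variable {Ω : Type*} {m : MeasurableSpace Ω} {P : Measure Ω} {𝒢 : Filtration ℕ m}
  {R : ℕ → Ω → ℝ} {J : Finset ℝ} {w : ℝ → ℝ≥0∞}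

lemma measurable_stepDensity (hR : ∀ n, Measurable[𝒢 n] (R n)) (n : ℕ) :
    Measurable[𝒢 (n + 1)] (stepDensity P 𝒢 R J w n) := by
  have hle : 𝒢 n ≤ 𝒢 (n + 1) := 𝒢.mono n.le_succ
  refine Measurable.ite ((hR n).mono hle le_rfl (measurableSet_singleton 0)) measurable_const ?_
  refine Finset.measurable_sum _ fun j _ => Measurable.indicator ?_
    (hR (n + 1) (measurableSet_singleton j))
  exact measurable_const.div
    ((stronglyMeasurable_condExp.measurable.mono hle le_rfl).ennreal_ofReal)

lemma measurable_pathDensity (hR : ∀ n, Measurable[𝒢 n] (R n)) (n : ℕ) :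
    Measurable[𝒢 n] (pathDensity P 𝒢 R J w n) :=
  Finset.measurable_prod _ fun i hi => (measurable_stepDensity hR i).mono
    (𝒢.mono (Nat.succ_le_of_lt (Finset.mem_range.1 hi))) le_rfl

lemma measurable_limitDensity (hR : ∀ n, Measurable[𝒢 n] (R n)) :
    Measurable (limitDensity P 𝒢 R J w) :=
  .liminf fun n => (measurable_pathDensity hR n).mono (𝒢.le n) le_rfl

lemma stepDensity_ne_zero (hJ : ∀ n ω, R (n + 1) ω ∈ J) (hw : ∀ j ∈ J, w j ≠ 0) (n : ℕ) (ω : Ω) :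
    stepDensity P 𝒢 R J w n ω ≠ 0 := by
  unfold stepDensity
  split_ifs with h
  · exact one_ne_zero
  · intro h0
    have := Finset.sum_eq_zero_iff.1 h0 _ (hJ n ω)
    simp [hw _ (hJ n ω)] at this

lemma pathDensity_eq_of_le {ω : Ω} (habs : ∀ n, R n ω = 0 → R (n + 1) ω = 0) {k n : ℕ}
    (hkn : k ≤ n) (hk : R k ω = 0) :
    R n ω = 0 ∧ pathDensity P 𝒢 R J w n ω = pathDensity P 𝒢 R J w k ω := by
  induction n, hkn using Nat.le_induction with
  | base => exact ⟨hk, rfl⟩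
  | succ n _ ih =>
    refine ⟨habs n ih.1, ?_⟩
    rw [← ih.2, pathDensity, Finset.prod_range_succ, stepDensity, if_pos ih.1, mul_one,
      pathDensity]

lemma limitDensity_eq {ω : Ω} (habs : ∀ n, R n ω = 0 → R (n + 1) ω = 0) {k : ℕ}
    (hk : R k ω = 0) : limitDensity P 𝒢 R J w ω = pathDensity P 𝒢 R J w k ω := by
  refine Tendsto.liminf_eq (tendsto_const_nhds.congr' ?_)
  filter_upwards [eventually_ge_atTop k] with n hn
  exact (pathDensity_eq_of_le habs hn hk).2.symm

variable [IsProbabilityMeasure P]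

lemma lintegral_mul_stepDensity (hR : ∀ n, Measurable[𝒢 n] (R n))
    (habs : ∀ᵐ ω ∂P, ∀ n, R n ω = 0 → R (n + 1) ω = 0)
    (hpos : ∀ n, ∀ j ∈ J, ∀ᵐ ω ∂P, R n ω ≠ 0 →
        0 < (P[({ω' | R (n + 1) ω' = j}).indicator (fun _ => (1:ℝ)) | 𝒢 n]) ω)
    (n : ℕ) {f : Ω → ℝ≥0∞} (hf : Measurable[𝒢 n] f) (g : ℝ → ℝ≥0∞) :
    ∫⁻ ω, f ω * stepDensity P 𝒢 R J w n ω * g (R (n + 1) ω) ∂P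
      = ∫⁻ ω, f ω * (if R n ω = 0 then g 0 else ∑ j ∈ J, w j * g j) ∂P := by
  have hle := 𝒢.le n
  set p : ℝ → Ω → ℝ≥0∞ := fun j ω => ENNReal.ofReal
    ((P[({ω' | R (n + 1) ω' = j}).indicator (fun _ => (1:ℝ)) | 𝒢 n]) ω) with hp
  have hpm : ∀ j, Measurable[𝒢 n] (p j) := fun j =>
    stronglyMeasurable_condExp.measurable.ennreal_ofReal
  have hS : MeasurableSet[𝒢 n] {ω | R n ω = 0} := hR n (measurableSet_singleton 0)
  have hA : ∀ j, MeasurableSet {ω | R (n + 1) ω = j} := fun j =>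
    𝒢.le _ _ (hR (n + 1) (measurableSet_singleton j))
  set a : Ω → ℝ≥0∞ := {ω | R n ω = 0}.indicator fun ω => f ω * g 0 with ha
  have ham : Measurable[𝒢 n] a := (hf.mul_const _).indicator hS
  set b : ℝ → Ω → ℝ≥0∞ := fun j => {ω | R n ω = 0}ᶜ.indicator fun ω => f ω * (w j / p j ω * g j)
    with hb
  have hbm : ∀ j, Measurable[𝒢 n] (b j) := fun j =>
    (hf.mul ((measurable_const.div (hpm j)).mul_const _)).indicator hS.compl
  calc
    _ = ∫⁻ ω, a ω + ∑ j ∈ J, b j ω * {ω' | R (n + 1) ω' = j}.indicator 1 ω ∂P := by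
      refine lintegral_congr_ae ?_
      filter_upwards [habs] with ω hω
      by_cases h : R n ω = 0
      · simp [ha, hb, stepDensity, h, hω n h]
      · simp only [stepDensity, h, if_false, ha, hb, mem_ofPred_eq, not_false_eq_true,
          indicator_of_notMem, zero_add, mem_compl_iff, indicator_of_mem, Finset.mul_sum,
          Finset.sum_mul]
        refine Finset.sum_congr rfl fun j _ => ?_
        by_cases hj : R (n + 1) ω = j
        · simp [hj, hp, mul_assoc]
        · simp [hj]
    _ = ∫⁻ ω, a ω ∂P + ∑ j ∈ J, ∫⁻ ω, b j ω * p j ω ∂P := by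
      rw [lintegral_add_left (ham.mono hle le_rfl), lintegral_finsetSum]
      · refine congrArg _ (Finset.sum_congr rfl fun j _ => ?_)
        exact lintegral_mul_indicator_eq_lintegral_mul_condExp P hle (hbm j) (hA j)
      · exact fun j _ => ((hbm j).mono hle le_rfl).mul (measurable_one.indicator (hA j))
    _ = ∫⁻ ω, a ω + ∑ j ∈ J, b j ω * p j ω ∂P := by
      rw [lintegral_add_left (ham.mono hle le_rfl), lintegral_finsetSum]
      exact fun j _ => ((hbm j).mul (hpm j)).mono hle le_rfl
    _ = _ := by
      refine lintegral_congr_ae ?_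
      filter_upwards [(Finset.eventually_all J).2 (hpos n)] with ω hω
      by_cases h : R n ω = 0
      · simp [ha, hb, h]
      · simp only [h, if_false, ha, hb, mem_ofPred_eq, not_false_eq_true,
          indicator_of_notMem, zero_add, mem_compl_iff, indicator_of_mem, Finset.mul_sum]
        refine Finset.sum_congr rfl fun j hj => ?_
        have h1 : p j ω ≠ 0 := by simpa [hp] using hω j hj h
        rw [mul_assoc, mul_right_comm, ENNReal.div_mul_cancel h1 ENNReal.ofReal_ne_top]

lemma lintegral_mul_pathDensity_of_le (hR : ∀ n, Measurable[𝒢 n] (R n))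
    (habs : ∀ᵐ ω ∂P, ∀ n, R n ω = 0 → R (n + 1) ω = 0)
    (hpos : ∀ n, ∀ j ∈ J, ∀ᵐ ω ∂P, R n ω ≠ 0 →
        0 < (P[({ω' | R (n + 1) ω' = j}).indicator (fun _ => (1:ℝ)) | 𝒢 n]) ω)
    (hw1 : ∑ j ∈ J, w j = 1)
    {n k : ℕ} (hnk : n ≤ k) {f : Ω → ℝ≥0∞} (hf : Measurable[𝒢 n] f) :
    ∫⁻ ω, f ω * pathDensity P 𝒢 R J w k ω ∂P = ∫⁻ ω, f ω * pathDensity P 𝒢 R J w n ω ∂P := by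
  induction k, hnk using Nat.le_induction with
  | base => rfl
  | succ k hk ih =>
    have hm : Measurable[𝒢 k] fun ω => f ω * pathDensity P 𝒢 R J w k ω :=
      (hf.mono (𝒢.mono hk) le_rfl).mul (measurable_pathDensity hR k)
    have := lintegral_mul_stepDensity (w := w) hR habs hpos k hm (fun _ => 1)
    simp only [mul_one, hw1, ite_self] at this
    rw [← ih, ← this]
    simp only [pathDensity, Finset.prod_range_succ, mul_assoc]

lemma lintegral_mul_pathDensity_alive (hR : ∀ n, Measurable[𝒢 n] (R n))
    (habs : ∀ᵐ ω ∂P, ∀ n, R n ω = 0 → R (n + 1) ω = 0)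
    (hpos : ∀ n, ∀ j ∈ J, ∀ᵐ ω ∂P, R n ω ≠ 0 →
        0 < (P[({ω' | R (n + 1) ω' = j}).indicator (fun _ => (1:ℝ)) | 𝒢 n]) ω)
    (n i : ℕ) {f : Ω → ℝ≥0∞} (hf : Measurable[𝒢 n] f) :
    ∫⁻ ω, f ω * pathDensity P 𝒢 R J w (n + i) ω * (if R (n + i) ω = 0 then 0 else 1) ∂P
      = (∑ j ∈ J, w j * if j = 0 then 0 else 1) ^ i *
        ∫⁻ ω, f ω * pathDensity P 𝒢 R J w n ω * (if R n ω = 0 then 0 else 1) ∂P := by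
  induction i with
  | zero => simp
  | succ i ih =>
    have hm : Measurable[𝒢 (n + i)] fun ω => f ω * pathDensity P 𝒢 R J w (n + i) ω :=
      (hf.mono (𝒢.mono (Nat.le_add_right n i)) le_rfl).mul (measurable_pathDensity hR (n + i))
    have := lintegral_mul_stepDensity (w := w) hR habs hpos (n + i) hm
      (fun x => if x = 0 then 0 else 1)
    rw [pow_succ', mul_assoc, ← ih, ← lintegral_const_mul]
    · rw [← add_assoc]
      refine Eq.trans ?_ (this.trans (lintegral_congr fun ω => ?_))
      · simp only [pathDensity, Finset.prod_range_succ, mul_assoc]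
      · by_cases h : R (n + i) ω = 0 <;> simp [h, mul_comm]
    · refine (hm.mono (𝒢.le _) le_rfl).mul (Measurable.ite ?_ measurable_const measurable_const)
      exact 𝒢.le _ _ (hR (n + i) (measurableSet_singleton 0))

lemma lintegral_mul_limitDensity (hR : ∀ n, Measurable[𝒢 n] (R n))
    (habs : ∀ᵐ ω ∂P, ∀ n, R n ω = 0 → R (n + 1) ω = 0)
    (hret : ∀ᵐ ω ∂P, ∃ n, R n ω = 0)
    (hpos : ∀ n, ∀ j ∈ J, ∀ᵐ ω ∂P, R n ω ≠ 0 →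
        0 < (P[({ω' | R (n + 1) ω' = j}).indicator (fun _ => (1:ℝ)) | 𝒢 n]) ω)
    (hw1 : ∑ j ∈ J, w j = 1) (hδ : (∑ j ∈ J, w j * if j = 0 then 0 else 1) < 1)
    {n : ℕ} {f : Ω → ℝ≥0∞} (hf : Measurable[𝒢 n] f)
    (hfin : ∫⁻ ω, f ω * pathDensity P 𝒢 R J w n ω ∂P ≠ ∞) :
    ∫⁻ ω, f ω * limitDensity P 𝒢 R J w ω ∂P = ∫⁻ ω, f ω * pathDensity P 𝒢 R J w n ω ∂P := by
  have hS : ∀ k, MeasurableSet {ω | R k ω = 0} := fun k =>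
    𝒢.le _ _ (hR k (measurableSet_singleton 0))
  have hf' : Measurable f := hf.mono (𝒢.le n) le_rfl
  have hpath : ∀ k, Measurable (pathDensity P 𝒢 R J w k) := fun k =>
    (measurable_pathDensity hR k).mono (𝒢.le k) le_rfl
  have hretired : Tendsto (fun i => ∫⁻ ω, f ω * pathDensity P 𝒢 R J w (n + i) ω *
      (if R (n + i) ω = 0 then 1 else 0) ∂P) atTop
      (𝓝 (∫⁻ ω, f ω * limitDensity P 𝒢 R J w ω ∂P)) := by
    refine lintegral_tendsto_of_tendsto_of_monotone (fun i => ?_) ?_ ?_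
    · exact ((hf'.mul (hpath _)).mul
        (Measurable.ite (hS _) measurable_const measurable_const)).aemeasurable
    · filter_upwards [habs] with ω hω
      refine monotone_nat_of_le_succ fun i => ?_
      by_cases h : R (n + i) ω = 0
      · have := pathDensity_eq_of_le (P := P) (𝒢 := 𝒢) (J := J) (w := w) hω
          (Nat.le_succ (n + i)) h
        simp only [← add_assoc, Nat.succ_eq_add_one] at this ⊢
        simp [this.1, this.2, h]
      · simp [h]
    · filter_upwards [habs, hret] with ω hω ⟨k, hk⟩
      refine tendsto_const_nhds.congr' ?_
      filter_upwards [eventually_ge_atTop k] with i hi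
      have h := (pathDensity_eq_of_le (P := P) (𝒢 := 𝒢) (J := J) (w := w) hω
        (show k ≤ n + i by omega) hk).1
      rw [limitDensity_eq hω h, if_pos h, mul_one]
  have halive : Tendsto (fun i => ∫⁻ ω, f ω * pathDensity P 𝒢 R J w (n + i) ω *
      (if R (n + i) ω = 0 then 0 else 1) ∂P) atTop (𝓝 0) := by
    simp only [lintegral_mul_pathDensity_alive hR habs hpos n _ hf]
    have hfin' : ∫⁻ ω, f ω * pathDensity P 𝒢 R J w n ω * (if R n ω = 0 then 0 else 1) ∂P ≠ ∞ := by
      refine ne_top_of_le_ne_top hfin (lintegral_mono fun ω => ?_)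
      dsimp only
      split_ifs <;> simp
    simpa using ENNReal.Tendsto.mul_const (ENNReal.tendsto_pow_atTop_nhds_zero_of_lt_one hδ)
      (Or.inr hfin')
  have hsum := hretired.add halive
  rw [add_zero] at hsum
  refine tendsto_nhds_unique hsum (tendsto_const_nhds.congr fun i => ?_)
  rw [← lintegral_mul_pathDensity_of_le hR habs hpos hw1 (Nat.le_add_right n i) hf,
    ← lintegral_add_left]
  swap
  · exact (hf'.mul (hpath _)).mul (Measurable.ite (hS _) measurable_const measurable_const)
  refine lintegral_congr fun ω => ?_
  split_ifs <;> simp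

end Density

/-- Lemma 2.6 of Guasoni–Rásonyi–Schachermayer (as used in the paper): any random walk with
retirement `Z_n = Z₀ (1+ε)^{R_1 + ⋯ + R_n}` admits an equivalent probability measure `Q ∼ P`
under which it is a uniformly integrable martingale. Here the retirement process `R` is
indexed so that `R 0 ≡ 1` encodes the convention `{R_0 ≠ 0} = Ω`, `R (n+1)` is the `n+1`-st
step (taking values in `{−1,0,1}`, adapted), (i) once `R` hits `0` it stays `0` a.s.,
(ii) conditionally on `𝒢_n`, on `{R_n ≠ 0}` each value `j ∈ {−1,0,1}` of `R_{n+1}` has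
positive conditional probability, and (iii) a.s. `R_n = 0` eventually. -/
theorem random_walk_with_retirement_has_equivalent_martingale_measure
    {Ω : Type*} {m : MeasurableSpace Ω} (P : Measure Ω) [IsProbabilityMeasure P]
    (𝒢 : Filtration ℕ m)
    (htriv : ∀ s : Set Ω, MeasurableSet[𝒢 0] s → P s = 0 ∨ P s = 1)
    (hsup : (⨆ n : ℕ, (𝒢 n : MeasurableSpace Ω)) = m)
    (ε : ℝ) (hε : 0 < ε) (Z0 : ℝ) (hZ0 : 0 < Z0)
    (R : ℕ → Ω → ℝ)
    (hR0 : ∀ ω, R 0 ω = 1)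
    (hadpR : ∀ n : ℕ, StronglyMeasurable[𝒢 (n + 1)] (R (n + 1)))
    (hvals : ∀ n : ℕ, ∀ ω, R (n + 1) ω ∈ ({-1, 0, 1} : Set ℝ))
    (hi : ∀ n : ℕ, P ({ω | R (n + 1) ω = 0} ∩ {ω | ∃ k, n + 1 ≤ k ∧ R k ω ≠ 0}) = 0)
    (hii : ∀ n : ℕ, ∀ j ∈ ({-1, 0, 1} : Set ℝ),
      ∀ᵐ ω ∂P, R n ω ≠ 0 →
        0 < (P[({ω' | R (n + 1) ω' = j}).indicator (fun _ => (1:ℝ)) | 𝒢 n]) ω)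
    (hiii : P {ω | ∀ n : ℕ, R (n + 1) ω ≠ 0} = 0) :
    ∃ Q : Measure Ω, IsProbabilityMeasure Q ∧ Q ≪ P ∧ P ≪ Q ∧
      Martingale (fun n ω => Z0 * (1 + ε) ^ (∑ i ∈ Finset.range n, R (i + 1) ω)) 𝒢 Q ∧
      UniformIntegrable
        (fun n ω => Z0 * (1 + ε) ^ (∑ i ∈ Finset.range n, R (i + 1) ω)) 1 Q := by
  set Z : ℕ → Ω → ℝ := fun n ω => Z0 * (1 + ε) ^ (∑ i ∈ Finset.range n, R (i + 1) ω) with hZ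
  have h1ε : 0 < 1 + ε := by linarith
  have hZsucc : ∀ n ω, Z (n + 1) ω = Z n ω * (1 + ε) ^ R (n + 1) ω := fun n ω => by
    simp only [hZ, Finset.sum_range_succ, Real.rpow_add h1ε, mul_assoc]
  have hZpos : ∀ n ω, 0 < Z n ω := fun n ω => mul_pos hZ0 (Real.rpow_pos_of_pos h1ε _)
  have hZle : ∀ n ω, Z n ω ≤ Z0 * (1 + ε) ^ n := fun n ω => by
    induction n with
    | zero => simp [hZ]
    | succ n ih =>
      rw [hZsucc, pow_succ, ← mul_assoc]
      refine mul_le_mul ih ?_ (Real.rpow_nonneg h1ε.le _) (by positivity)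
      conv_rhs => rw [← Real.rpow_one (1 + ε)]
      refine Real.rpow_le_rpow_of_exponent_le (by linarith) ?_
      rcases hvals n ω with h | h | h <;> rw [h] <;> norm_num
  have hR : ∀ n, Measurable[𝒢 n] (R n) := fun n => by
    cases n with
    | zero => rw [show R 0 = fun _ => 1 from funext hR0]; exact measurable_const
    | succ n => exact (hadpR n).measurable
  have hZm : ∀ n, Measurable[𝒢 n] (Z n) := fun n => by
    refine measurable_const.mul (measurable_const.pow (Finset.measurable_sum _ fun i hi => ?_))
    exact (hR (i + 1)).mono (𝒢.mono (Nat.succ_le_of_lt (Finset.mem_range.1 hi))) le_rfl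
  have habs : ∀ᵐ ω ∂P, ∀ n, R n ω = 0 → R (n + 1) ω = 0 := by
    refine ae_all_iff.2 fun n => ?_
    cases n with
    | zero => exact ae_of_all _ fun ω h => by simp [hR0] at h
    | succ n =>
      filter_upwards [measure_eq_zero_iff_ae_notMem.1 (hi n)] with ω hω h
      by_contra h'
      exact hω ⟨h, n + 1 + 1, Nat.le_succ _, h'⟩
  have hret : ∀ᵐ ω ∂P, ∃ n, R n ω = 0 := by
    filter_upwards [measure_eq_zero_iff_ae_notMem.1 hiii] with ω hω
    simp only [not_forall, not_not] at hω
    exact hω.imp' (· + 1) fun _ h => h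
  set J : Finset ℝ := {-1, 0, 1} with hJdef
  have hJ : ∀ n ω, R (n + 1) ω ∈ J := fun n ω => by simpa [hJdef] using hvals n ω
  have hpos : ∀ n, ∀ j ∈ J, ∀ᵐ ω ∂P, R n ω ≠ 0 →
      0 < (P[({ω' | R (n + 1) ω' = j}).indicator (fun _ => (1:ℝ)) | 𝒢 n]) ω :=
    fun n j hj => hii n j (by simpa [hJdef] using hj)
  set a : ℝ := 1 / (2 * (1 + ε) * (2 + ε)) with ha
  have ha0 : 0 < a := by positivity
  have haδ : (2 + ε) * a = 1 / (2 * (1 + ε)) := by rw [ha]; field_simp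
  have hδ1 : 1 / (2 * (1 + ε)) < 1 := by rw [div_lt_one (by positivity)]; linarith
  set w : ℝ → ℝ≥0∞ := fun j => ENNReal.ofReal
    (if j = 1 then a else if j = -1 then (1 + ε) * a else 1 - (2 + ε) * a) with hw
  have hv0 : 0 < 1 - (2 + ε) * a := by linarith
  have hv1 : 0 < (1 + ε) * a := by positivity
  have hsumJ : ∀ g : ℝ → ℝ, (∀ x, 0 ≤ g x) → ∑ j ∈ J, w j * ENNReal.ofReal (g j)
      = ENNReal.ofReal ((1 + ε) * a * g (-1) + (1 - (2 + ε) * a) * g 0 + a * g 1) := fun g hg => by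
    have h0 := mul_nonneg hv0.le (hg 0)
    have h1 := mul_nonneg hv1.le (hg (-1))
    have h2 := mul_nonneg ha0.le (hg 1)
    rw [hJdef, Finset.sum_insert (by norm_num), Finset.sum_insert (by norm_num),
      Finset.sum_singleton, ENNReal.ofReal_add (by positivity) h2, ENNReal.ofReal_add h1 h0,
      ENNReal.ofReal_mul hv1.le, ENNReal.ofReal_mul hv0.le, ENNReal.ofReal_mul ha0.le, add_assoc]
    norm_num [hw]
  have hwne : ∀ j ∈ J, w j ≠ 0 := fun j _ => by
    simp only [hw, ne_eq, ENNReal.ofReal_eq_zero, not_le]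
    split_ifs <;> assumption
  have hw1 : ∑ j ∈ J, w j = 1 := by
    have := hsumJ (fun _ => 1) (fun _ => zero_le_one)
    simp only [ENNReal.ofReal_one, mul_one] at this
    rw [this, ← ENNReal.ofReal_one]
    congr 1
    ring
  have hδ : (∑ j ∈ J, w j * if j = 0 then 0 else 1) = ENNReal.ofReal (1 / (2 * (1 + ε))) := by
    have := hsumJ (fun x => if x = 0 then 0 else 1) (fun x => by split_ifs <;> norm_num)
    simp only [apply_ite ENNReal.ofReal, ENNReal.ofReal_one, ENNReal.ofReal_zero] at this
    rw [this, ← haδ]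
    congr 1
    norm_num
    ring
  have hwg : ∑ j ∈ J, w j * ENNReal.ofReal ((1 + ε) ^ j) = 1 := by
    rw [hsumJ (fun x => (1 + ε) ^ x) fun x => Real.rpow_nonneg h1ε.le x, ← ENNReal.ofReal_one]
    congr 1
    rw [Real.rpow_neg_one, Real.rpow_zero, Real.rpow_one]
    field_simp
    ring
  set L := limitDensity P 𝒢 R J w with hL
  have hLm : Measurable L := measurable_limitDensity hR
  have hL0 : ∀ᵐ ω ∂P, L ω ≠ 0 := by
    filter_upwards [habs, hret] with ω hω ⟨k, hk⟩
    rw [hL, limitDensity_eq hω hk]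
    exact Finset.prod_ne_zero_iff.2 fun i _ => stepDensity_ne_zero hJ hwne i ω
  have hpath1 : ∀ n, ∫⁻ ω, pathDensity P 𝒢 R J w n ω ∂P = 1 := fun n => by
    simpa [pathDensity] using lintegral_mul_pathDensity_of_le hR habs hpos hw1 (Nat.zero_le n)
      (measurable_const (a := (1 : ℝ≥0∞)))
  set Q := P.withDensity L with hQdef
  have hQ : ∀ n (f : Ω → ℝ≥0∞) (C : ℝ), Measurable[𝒢 n] f → (∀ ω, f ω ≤ ENNReal.ofReal C) →
      ∫⁻ ω, f ω ∂Q = ∫⁻ ω, f ω * pathDensity P 𝒢 R J w n ω ∂P := fun n f C hf hC => by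
    rw [hQdef, lintegral_withDensity_eq_lintegral_mul _ hLm (hf.mono (𝒢.le n) le_rfl),
      ← lintegral_mul_limitDensity hR habs hret hpos hw1
        (hδ.trans_lt (ENNReal.ofReal_lt_one.2 hδ1)) hf]
    · exact lintegral_congr fun ω => mul_comm _ _
    · have : ∫⁻ ω, ENNReal.ofReal C * pathDensity P 𝒢 R J w n ω ∂P ≠ ∞ := by
        rw [lintegral_const_mul _ ((measurable_pathDensity hR n).mono (𝒢.le n) le_rfl), hpath1]
        simp
      exact ne_top_of_le_ne_top this (lintegral_mono fun ω => by gcongr; exact hC ω)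
  have hQprob : IsProbabilityMeasure Q := ⟨by
    rw [← lintegral_one, hQ 0 (fun _ => 1) 1 measurable_const (by simp)]
    simpa using hpath1 0⟩
  have hZsm : ∀ n, AEStronglyMeasurable (Z n) Q := fun n =>
    ((hZm n).mono (𝒢.le n) le_rfl).aestronglyMeasurable
  set G : Ω → ℝ≥0∞ := fun ω => ENNReal.ofReal Z0 +
    ∑' k, ENNReal.ofReal (Z0 * (1 + ε) ^ k) * (if R k ω = 0 then 0 else 1) with hG
  have halive : ∀ k, Measurable[𝒢 k] fun ω => (if R k ω = 0 then 0 else 1 : ℝ≥0∞) := fun k =>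
    Measurable.ite (hR k (measurableSet_singleton 0)) measurable_const measurable_const
  have halive' : ∀ k, Measurable fun ω =>
      ENNReal.ofReal (Z0 * (1 + ε) ^ k) * (if R k ω = 0 then 0 else 1) := fun k =>
    ((halive k).mono (𝒢.le k) le_rfl).const_mul _
  have hGm : Measurable G := measurable_const.add (Measurable.tsum halive')
  have hZG : ∀ n ω, ENNReal.ofReal (Z n ω) ≤ G ω := fun n ω => by
    induction n with
    | zero => simp [hZ, hG]
    | succ n ih =>
      by_cases h : R (n + 1) ω = 0
      · simpa [hZsucc, h] using ih
      · refine (ENNReal.ofReal_le_ofReal (hZle (n + 1) ω)).trans (le_add_left ?_)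
        refine le_trans ?_ (ENNReal.le_tsum (n + 1))
        simp [h]
  have hGint : ∫⁻ ω, G ω ∂Q ≠ ∞ := by
    rw [hG, lintegral_add_left measurable_const, lintegral_tsum fun k => (halive' k).aemeasurable]
    refine ENNReal.add_ne_top.2 ⟨by simp, ?_⟩
    refine ne_top_of_le_ne_top (Summable.tsum_ofReal_ne_top
      (summable_geometric_two.mul_left Z0)) (ENNReal.tsum_le_tsum fun k => ?_)
    have h1 : ∫⁻ ω, (if R k ω = 0 then 0 else 1) ∂Q ≤ ENNReal.ofReal (1 / (2 * (1 + ε))) ^ k := by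
      rw [hQ k _ 1 (halive k) (fun ω => by split_ifs <;> simp)]
      have := lintegral_mul_pathDensity_alive (w := w) hR habs hpos 0 k
        (measurable_const (a := (1 : ℝ≥0∞)))
      simp only [one_mul, zero_add, hδ, hR0, pathDensity, Finset.range_zero, Finset.prod_empty,
        one_ne_zero, if_false, lintegral_one, measure_univ, mul_one] at this
      simpa only [← this, pathDensity] using (lintegral_congr fun ω => mul_comm _ _).le
    rw [lintegral_const_mul _ ((halive k).mono (𝒢.le k) le_rfl)]
    refine (mul_le_mul_right h1 _).trans_eq ?_
    rw [← ENNReal.ofReal_pow (by positivity), ← ENNReal.ofReal_mul (by positivity)]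
    congr 1
    rw [mul_assoc, ← mul_pow]
    congr 2
    field_simp
  have hGr : Integrable (fun ω => (G ω).toReal) Q :=
    integrable_toReal_of_lintegral_ne_top hGm.aemeasurable hGint
  have hdom : ∀ n, ∀ᵐ ω ∂Q, ‖Z n ω‖ ≤ ‖(G ω).toReal‖ := fun n => by
    filter_upwards [ae_lt_top hGm hGint] with ω hω
    rw [Real.norm_of_nonneg (hZpos n ω).le, Real.norm_of_nonneg ENNReal.toReal_nonneg]
    exact (ENNReal.ofReal_le_iff_le_toReal hω.ne).1 (hZG n ω)
  refine ⟨Q, hQprob, withDensity_absolutelyContinuous _ _,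
    withDensity_absolutelyContinuous' hLm.aemeasurable hL0, ?_,
    uniformIntegrable_of_norm_le hZsm hGr hdom⟩
  refine martingale_of_setIntegral_eq_succ (fun n => (hZm n).stronglyMeasurable)
    (fun n => hGr.mono (hZsm n) (hdom n)) fun n s hs => ?_
  have hset : ∀ k, MeasurableSet[𝒢 k] s → ∫ ω in s, Z k ω ∂Q = (∫⁻ ω,
      s.indicator (fun ω => ENNReal.ofReal (Z k ω)) ω * pathDensity P 𝒢 R J w k ω ∂P).toReal := by
    intro k hsk
    rw [integral_eq_lintegral_of_nonneg_ae (ae_of_all _ fun ω => (hZpos k ω).le) (hZsm k).restrict,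
      ← lintegral_indicator (𝒢.le k _ hsk), hQ k _ (Z0 * (1 + ε) ^ k)
        ((hZm k).ennreal_ofReal.indicator hsk)]
    exact fun ω => (indicator_le_self _ _ ω).trans (ENNReal.ofReal_le_ofReal (hZle k ω))
  rw [hset n hs, hset (n + 1) (𝒢.mono n.le_succ _ hs)]
  have hm : Measurable[𝒢 n] fun ω =>
      s.indicator (fun ω => ENNReal.ofReal (Z n ω)) ω * pathDensity P 𝒢 R J w n ω :=
    ((hZm n).ennreal_ofReal.indicator hs).mul (measurable_pathDensity hR n)
  have := lintegral_mul_stepDensity (w := w) hR habs hpos n hm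
    (fun x => ENNReal.ofReal ((1 + ε) ^ x))
  simp only [hwg, Real.rpow_zero, ENNReal.ofReal_one, ite_self, mul_one] at this
  rw [← this]
  congr 1
  refine lintegral_congr fun ω => ?_
  by_cases hω : ω ∈ s
  · simp only [hω, indicator_of_mem, hZsucc, ENNReal.ofReal_mul (hZpos n ω).le, pathDensity,
      Finset.prod_range_succ]
    ring
  · simp [hω]

end
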